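/- (Iwasawa's theorem) A finite group G is supersolvable if and only if all maximal chains of the trivial subgroup in G have the same length. -/

import Mathlib

/-- A maximal chain of `H` in the ambient group of length `r`: a chain
`H = c 0 < c 1 < ... < c r = ⊤` where each `c i` is a maximal subgroup of `c (i+1)`,
i.e. each step is a covering relation in the subgroup lattice. -/
def IsMaxChainOf {G : Type*} [Group G] (H : Subgroup G) (r : ℕ) (c : ℕ → Subgroup G) : Prop :=
  c 0 = H ∧ c r = ⊤ ∧ ∀ i < r, c i ⋖ c (i + 1)

/-- All maximal chains of `H` in the ambient group have the same length. -/
def AllMaxChainsSameLength {G : Type*} [Group G] (H : Subgroup G) : Prop :=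
  ∀ (r s : ℕ) (c d : ℕ → Subgroup G),
    IsMaxChainOf H r c → IsMaxChainOf H s d → r = s


/-- A group is supersolvable if it has a normal series (all terms normal in the whole
group) with cyclic factors.  The factor `s (i+1) / s i` being cyclic is encoded as:
some single element `g` together with `s i` generates `s (i+1)`. -/
def IsSupersolvable (G : Type*) [Group G] : Prop :=
  ∃ (n : ℕ) (s : ℕ → Subgroup G), s 0 = ⊥ ∧ s n = ⊤ ∧ (∀ i, (s i).Normal) ∧
    ∀ i < n, ∃ g : G, s i ⊔ Subgroup.zpowers g = s (i + 1)

namespace Subgroup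

variable {G G' : Type*} [Group G] [Group G']

/-- A homomorphism preserves a covering relation `A ⋖ B` when `B ⊓ ker f ≤ A`. -/
theorem covBy_map {A B : Subgroup G} (f : G →* G') (hAB : A ⋖ B) (h : B ⊓ f.ker ≤ A) :
    A.map f ⋖ B.map f := by
  refine ⟨lt_of_le_not_ge (map_mono hAB.le) fun hle => hAB.lt.not_ge fun b hb => ?_,
    fun L hAL hLB => ?_⟩
  · obtain ⟨a, ha, hab⟩ := hle (mem_map_of_mem f hb)
    have hk : a⁻¹ * b ∈ A := h (mem_inf.2 ⟨mul_mem (inv_mem (hAB.le ha)) hb, by simp [MonoidHom.mem_ker, hab]⟩)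
    simpa using mul_mem ha hk
  · have hL : (L.comap f ⊓ B).map f = L := by
      ext x
      constructor
      · rintro ⟨y, ⟨hy, -⟩, rfl⟩
        exact hy
      · intro hx
        obtain ⟨y, hy, rfl⟩ := hLB.le hx
        exact ⟨y, ⟨hx, hy⟩, rfl⟩
    rcases hAB.eq_or_eq (c := L.comap f ⊓ B) (le_inf (map_le_iff_le_comap.1 hAL.le) hAB.le)
      inf_le_right with h1 | h1
    · rw [h1] at hL
      exact hAL.ne hL
    · rw [h1] at hL
      exact hLB.ne hL.symm

theorem covBy_comap_of_surjective {A B : Subgroup G'} {f : G →* G'} (hf : Function.Surjective f)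
    (hAB : A ⋖ B) : A.comap f ⋖ B.comap f := by
  refine ⟨(comap_lt_comap_of_surjective hf).2 hAB.lt, fun L hAL hLB => ?_⟩
  have hk : (L.map f).comap f = L := by
    rw [comap_map_eq, sup_eq_left]
    exact (ker_le_comap f A).trans hAL.le
  rw [← hk] at hAL hLB
  exact hAB.2 ((comap_lt_comap_of_surjective hf).1 hAL) ((comap_lt_comap_of_surjective hf).1 hLB)

theorem relIndex_map_of_inf_ker_le {A B : Subgroup G} (f : G →* G') (hAB : A ≤ B)
    (h : B ⊓ f.ker ≤ A) : (A.map f).relIndex (B.map f) = A.relIndex B := by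
  rw [← relIndex_comap, ← inf_relIndex_right]
  congr 1
  refine le_antisymm ?_ (le_inf (le_comap_map f A) hAB)
  rintro b ⟨⟨a, ha, hab⟩, hb⟩
  have hk : a⁻¹ * b ∈ A := h (mem_inf.2 ⟨mul_mem (inv_mem (hAB ha)) hb, by simp [MonoidHom.mem_ker, hab]⟩)
  simpa using mul_mem ha hk

theorem relIndex_sup_of_disjoint [Finite G] {H N : Subgroup G} [N.Normal] (h : Disjoint H N) :
    H.relIndex (H ⊔ N) = Nat.card N := by
  have h1 := relIndex_mul_relIndex ⊥ H (H ⊔ N) bot_le le_sup_left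
  have h2 := relIndex_mul_relIndex ⊥ N (H ⊔ N) bot_le le_sup_right
  rw [relIndex_sup_right, ← inf_relIndex_right N H, inf_comm, h.eq_bot] at h2
  simp only [relIndex_bot_left] at h1 h2
  refine Nat.eq_of_mul_eq_mul_left (Nat.card_pos (α := H)) ?_
  rw [h1, ← h2, mul_comm]

end Subgroup

/-- Every covering relation in the subgroup lattice has prime index. -/
def PrimeCovers (G : Type*) [Group G] : Prop :=
  ∀ H K : Subgroup G, H ⋖ K → (H.relIndex K).Prime

namespace PrimeCovers

variable {G G' : Type*} [Group G] [Group G']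

theorem of_injective (h : PrimeCovers G) {f : G' →* G} (hf : Function.Injective f) :
    PrimeCovers G' := fun H K hHK => by
  have hker : K ⊓ f.ker ≤ H := by simp [(MonoidHom.ker_eq_bot_iff f).2 hf]
  rw [← Subgroup.relIndex_map_of_inf_ker_le f hHK.le hker]
  exact h _ _ (Subgroup.covBy_map f hHK hker)

theorem subgroup (h : PrimeCovers G) (K : Subgroup G) : PrimeCovers K :=
  h.of_injective K.subtype_injective

theorem of_surjective (h : PrimeCovers G) {f : G →* G'} (hf : Function.Surjective f) :
    PrimeCovers G' := fun H K hHK => by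
  have := h _ _ (Subgroup.covBy_comap_of_surjective hf hHK)
  rwa [Subgroup.relIndex_comap, Subgroup.map_comap_eq_self_of_surjective hf] at this

/-- Covering pairs below a subgroup with `PrimeCovers` have prime index. -/
theorem prime_relIndex {K : Subgroup G} (h : PrimeCovers K) {A B : Subgroup G} (hAB : A ⋖ B)
    (hB : B ≤ K) : (A.relIndex B).Prime := by
  have h1 : A.subgroupOf K ⋖ B.subgroupOf K := by
    refine ⟨?_, fun L hAL hLB => ?_⟩
    · refine lt_of_le_not_ge (Subgroup.comap_mono hAB.le) fun hle => hAB.lt.not_ge fun b hb => ?_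
      exact hle (x := ⟨b, hB hb⟩) hb
    · have e1 := (Subgroup.map_lt_map_iff_of_injective K.subtype_injective).2 hAL
      have e2 := (Subgroup.map_lt_map_iff_of_injective K.subtype_injective).2 hLB
      rw [Subgroup.map_subgroupOf_eq_of_le (hAB.le.trans hB)] at e1
      rw [Subgroup.map_subgroupOf_eq_of_le hB] at e2
      exact hAB.2 e1 e2
  rw [← Subgroup.relIndex_subgroupOf hB]
  exact h _ _ h1

end PrimeCovers

/-- A saturated chain from `a` to a second element, of the given length. -/
inductive CovChain {α : Type*} [PartialOrder α] (a : α) : α → ℕ → Prop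
  | refl : CovChain a a 0
  | step {b c : α} {n : ℕ} : CovChain a b n → b ⋖ c → CovChain a c (n + 1)

namespace CovChain

section Order

variable {α β : Type*} [PartialOrder α] [PartialOrder β] {a b c : α} {n m : ℕ}

theorem trans (h : CovChain a b n) (h' : CovChain b c m) : CovChain a c (n + m) := by
  induction h' with
  | refl => exact h
  | step _ hc ih => exact ih.step hc

theorem map (f : α → β) (hf : ∀ a b, a ⋖ b → f a ⋖ f b) (h : CovChain a b n) :
    CovChain (f a) (f b) n := by
  induction h with
  | refl => exact .refl
  | step _ hc ih => exact ih.step (hf _ _ hc)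

theorem exists_of_le [Finite α] (hab : a ≤ b) : ∃ n, CovChain a b n := by
  induction b using WellFoundedLT.induction with
  | ind b ih =>
    rcases hab.eq_or_lt with rfl | hlt
    · exact ⟨0, .refl⟩
    · obtain ⟨x, hax, hxb⟩ := exists_le_covBy_of_lt hlt
      obtain ⟨n, hn⟩ := ih x hxb.lt hax
      exact ⟨n + 1, hn.step hxb⟩

theorem of_function (c : ℕ → α) (hc : ∀ i < n, c i ⋖ c (i + 1)) : CovChain (c 0) (c n) n := by
  induction n with
  | zero => exact .refl
  | succ n ih => exact (ih fun i hi => hc i (by omega)).step (hc n (by omega))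

theorem exists_function (h : CovChain a b n) :
    ∃ c : ℕ → α, c 0 = a ∧ c n = b ∧ ∀ i < n, c i ⋖ c (i + 1) := by
  induction h with
  | refl => exact ⟨fun _ => a, rfl, rfl, by simp⟩
  | @step b d n _ hbd ih =>
    obtain ⟨c, h0, hn, hc⟩ := ih
    refine ⟨fun i => if i ≤ n then c i else d, by simp [h0], by simp, fun i hi => ?_⟩
    rcases (Nat.lt_succ_iff.1 hi).eq_or_lt with rfl | hi'
    · simpa [hn] using hbd
    · simpa [hi'.le, Nat.succ_le_of_lt hi'] using hc i hi'

end Order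

variable {G : Type*} [Group G] [Finite G]

open ArithmeticFunction in
/-- In a chain of steps of prime index, the length is the number of prime factors. -/
theorem cardFactors_card {K : Subgroup G} (hK : PrimeCovers K) {n : ℕ}
    {H : Subgroup G} (h : CovChain ⊥ H n) (hH : H ≤ K) : cardFactors (Nat.card H) = n := by
  induction h with
  | refl => simp
  | @step b c n _ hbc ih =>
    have h1 := Subgroup.relIndex_mul_relIndex ⊥ b c bot_le hbc.le
    simp only [Subgroup.relIndex_bot_left] at h1
    have hp := hK.prime_relIndex hbc hH
    rw [← h1, cardFactors_mul Nat.card_pos.ne' hp.ne_zero, ih (hbc.le.trans hH),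
      cardFactors_apply_prime hp]

end CovChain

theorem allMaxChainsSameLength_bot_iff {G : Type*} [Group G] :
    AllMaxChainsSameLength (⊥ : Subgroup G) ↔
      ∀ n m, CovChain (⊥ : Subgroup G) ⊤ n → CovChain (⊥ : Subgroup G) ⊤ m → n = m := by
  constructor
  · intro h n m hn hm
    obtain ⟨c, hc⟩ := hn.exists_function
    obtain ⟨d, hd⟩ := hm.exists_function
    exact h n m c d hc hd
  · rintro h r s c d ⟨c0, cr, hc⟩ ⟨d0, ds, hd⟩
    refine h r s ?_ ?_
    · simpa [c0, cr] using CovChain.of_function c hc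
    · simpa [d0, ds] using CovChain.of_function d hd

namespace AllMaxChainsSameLength

variable {G G' : Type*} [Group G] [Finite G] [Group G']

theorem subgroup (h : AllMaxChainsSameLength (⊥ : Subgroup G)) (K : Subgroup G) :
    AllMaxChainsSameLength (⊥ : Subgroup K) := by
  rw [allMaxChainsSameLength_bot_iff] at h ⊢
  intro n m hn hm
  obtain ⟨k, hk⟩ := CovChain.exists_of_le (le_top : K ≤ ⊤)
  have key : ∀ n, CovChain (⊥ : Subgroup K) ⊤ n → CovChain (⊥ : Subgroup G) ⊤ (n + k) := by
    intro n hn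
    have := hn.map (Subgroup.map K.subtype) fun A B hAB => Subgroup.covBy_map _ hAB (by simp)
    rw [Subgroup.map_bot, ← MonoidHom.range_eq_map, Subgroup.range_subtype] at this
    exact this.trans hk
  exact Nat.add_right_cancel (h _ _ (key n hn) (key m hm))

theorem of_surjective (h : AllMaxChainsSameLength (⊥ : Subgroup G)) {f : G →* G'}
    (hf : Function.Surjective f) : AllMaxChainsSameLength (⊥ : Subgroup G') := by
  rw [allMaxChainsSameLength_bot_iff] at h ⊢
  intro n m hn hm
  obtain ⟨k, hk⟩ := CovChain.exists_of_le (bot_le : ⊥ ≤ f.ker)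
  have key : ∀ n, CovChain (⊥ : Subgroup G') ⊤ n → CovChain (⊥ : Subgroup G) ⊤ (k + n) := by
    intro n hn
    have := hn.map (Subgroup.comap f) fun A B hAB => Subgroup.covBy_comap_of_surjective hf hAB
    rw [MonoidHom.comap_bot, Subgroup.comap_top] at this
    exact hk.trans this
  exact Nat.add_left_cancel (h _ _ (key n hn) (key m hm))

end AllMaxChainsSameLength

theorem PrimeCovers.allMaxChainsSameLength {G : Type*} [Group G] [Finite G] (h : PrimeCovers G) :
    AllMaxChainsSameLength (⊥ : Subgroup G) := by
  rw [allMaxChainsSameLength_bot_iff]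
  intro n m hn hm
  rw [← hn.cardFactors_card (h.subgroup ⊤) le_rfl, ← hm.cardFactors_card (h.subgroup ⊤) le_rfl]

namespace IsSupersolvable

variable {G G' : Type*} [Group G] [Group G']

theorem of_surjective (h : IsSupersolvable G) {f : G →* G'} (hf : Function.Surjective f) :
    IsSupersolvable G' := by
  obtain ⟨n, s, h0, hn, hs, hg⟩ := h
  refine ⟨n, fun i => (s i).map f, by simp [h0], by simp [hn, Subgroup.map_top_of_surjective f hf],
    fun i => (hs i).map f hf, fun i hi => ?_⟩
  obtain ⟨g, hg⟩ := hg i hi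
  exact ⟨f g, by beta_reduce; rw [← hg, Subgroup.map_sup, MonoidHom.map_zpowers]⟩

theorem of_quotient {N : Subgroup G} [N.Normal] (hN : IsCyclic N) (h : IsSupersolvable (G ⧸ N)) :
    IsSupersolvable G := by
  obtain ⟨n, s, h0, hn, hs, hg⟩ := h
  let t : ℕ → Subgroup G := fun i =>
    match i with
    | 0 => ⊥
    | i + 1 => (s i).comap (QuotientGroup.mk' N)
  refine ⟨n + 1, t, rfl, by simp [t, hn], fun i => ?_, fun i hi => ?_⟩
  · cases i with
    | zero => exact inferInstanceAs (⊥ : Subgroup G).Normal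
    | succ i => exact (hs i).comap _
  · cases i with
    | zero =>
      obtain ⟨g, hg⟩ := (Subgroup.isCyclic_iff_exists_zpowers_eq_top N).1 hN
      exact ⟨g, by simp [t, h0, hg, MonoidHom.comap_bot]⟩
    | succ i =>
      obtain ⟨x, hx⟩ := hg i (by omega)
      obtain ⟨g, rfl⟩ := QuotientGroup.mk'_surjective N x
      refine ⟨g, ?_⟩
      change (s i).comap _ ⊔ _ = (s (i + 1)).comap _
      rw [← hx, ← MonoidHom.map_zpowers, ← Subgroup.comap_sup_eq _ _ _
        (QuotientGroup.mk'_surjective N), Subgroup.comap_map_eq, ← sup_assoc, sup_right_comm,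
        sup_eq_left.2 (Subgroup.ker_le_comap _ _)]

theorem exists_normal_prime_card [Finite G] [Nontrivial G] (h : IsSupersolvable G) :
    ∃ N : Subgroup G, N.Normal ∧ (Nat.card N).Prime := by
  classical
  obtain ⟨n, s, h0, hn, hs, hg⟩ := h
  have hex : ∃ i, s i ≠ ⊥ := ⟨n, by rw [hn]; exact top_ne_bot⟩
  obtain ⟨i, hi⟩ : ∃ i, Nat.find hex = i + 1 := Nat.exists_eq_succ_of_ne_zero fun h => by
    have := Nat.find_spec hex
    rw [h] at this
    exact this h0
  have hi0 : s i = ⊥ := not_not.1 (Nat.find_min hex (m := i) (by omega))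
  have hi1 : s (i + 1) ≠ ⊥ := hi ▸ Nat.find_spec hex
  have hin : i < n := by
    have := Nat.find_min' hex (m := n) (by rw [hn]; exact top_ne_bot)
    omega
  obtain ⟨g, hg⟩ := hg i hin
  rw [hi0, bot_sup_eq] at hg
  have hnorm : (Subgroup.zpowers g).Normal := hg ▸ hs (i + 1)
  have hg1 : orderOf g ≠ 1 := by
    rw [Ne, orderOf_eq_one_iff]
    rintro rfl
    exact hi1 (by rw [← hg, Subgroup.zpowers_one_eq_bot])
  obtain ⟨p, hp, m, hm⟩ := Nat.exists_prime_and_dvd hg1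
  have hpos := orderOf_pos g
  have hm0 : m ≠ 0 := by rintro rfl; exact hpos.ne' (by simpa using hm)
  refine ⟨Subgroup.zpowers (g ^ m), ⟨?_⟩, ?_⟩
  · rintro _ ⟨k, rfl⟩ x
    obtain ⟨j, hj⟩ := hnorm.conj_mem g (Subgroup.mem_zpowers g) x
    refine ⟨j * k, ?_⟩
    have : x * (g ^ m) ^ k * x⁻¹ = (x * g * x⁻¹) ^ (m * k : ℤ) := by
      rw [conj_zpow, zpow_mul, zpow_natCast]
    simp only [this, ← hj]
    rw [← zpow_natCast, ← zpow_mul, ← zpow_mul]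
    congr 1
    ring
  · rw [Nat.card_zpowers, orderOf_pow_of_dvd hm0 ⟨p, by rw [hm, mul_comm]⟩, hm,
      Nat.mul_div_cancel _ (Nat.pos_of_ne_zero hm0)]
    exact hp

end IsSupersolvable

theorem Subgroup.eq_bot_or_le_of_prime_card {G : Type*} [Group G] [Finite G] {N : Subgroup G}
    (hN : (Nat.card N).Prime) (K : Subgroup G) : K ⊓ N = ⊥ ∨ N ≤ K := by
  rcases (Nat.dvd_prime hN).1 (Subgroup.card_dvd_of_le (inf_le_right : K ⊓ N ≤ N)) with h | h
  · exact .inl (Subgroup.card_eq_one.1 h)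
  · exact .inr (inf_eq_right.1 (Subgroup.eq_of_le_of_card_ge inf_le_right h.ge))

theorem Subgroup.card_quotient_lt {G : Type*} [Group G] [Finite G] {N : Subgroup G}
    (hN : N ≠ ⊥) : Nat.card (G ⧸ N) < Nat.card G := by
  rw [N.card_eq_card_quotient_mul_card_subgroup]
  exact lt_mul_of_one_lt_right Nat.card_pos (N.one_lt_card_iff_ne_bot.2 hN)

theorem Subgroup.ne_bot_of_prime_card {G : Type*} [Group G] {N : Subgroup G}
    (hN : (Nat.card N).Prime) : N ≠ ⊥ := by
  rintro rfl
  simp [Nat.not_prime_one] at hN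

theorem IsSupersolvable.primeCovers {G : Type*} [Group G] [Finite G] (h : IsSupersolvable G) :
    PrimeCovers G := by
  induction hn : Nat.card G using Nat.strong_induction_on generalizing G with
  | _ n ih =>
  subst hn
  intro H K hHK
  have : Nontrivial G := by
    by_contra hG
    rw [not_nontrivial_iff_subsingleton] at hG
    exact hHK.ne (Subsingleton.elim _ _)
  obtain ⟨N, hN, hp⟩ := h.exists_normal_prime_card
  by_cases hNH : K ⊓ N ≤ H
  · have hker : K ⊓ (QuotientGroup.mk' N).ker ≤ H := by rwa [QuotientGroup.ker_mk']
    rw [← Subgroup.relIndex_map_of_inf_ker_le (QuotientGroup.mk' N) hHK.le hker]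
    exact ih _ (Subgroup.card_quotient_lt (Subgroup.ne_bot_of_prime_card hp))
      (h.of_surjective (QuotientGroup.mk'_surjective N)) rfl _ _ (Subgroup.covBy_map _ hHK hker)
  · have hNK : N ≤ K := (Subgroup.eq_bot_or_le_of_prime_card hp K).resolve_left
      fun h => hNH (h ▸ bot_le)
    rw [inf_eq_right.2 hNK] at hNH
    have hd : Disjoint H N := disjoint_iff.2
      ((Subgroup.eq_bot_or_le_of_prime_card hp H).resolve_right hNH)
    have hK : H ⊔ N = K := (hHK.eq_or_eq le_sup_left (sup_le hHK.le hNK)).resolve_left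
      fun h => hNH (sup_eq_left.1 h)
    rwa [← hK, Subgroup.relIndex_sup_of_disjoint hd]

theorem Nat.exists_max_prime_dvd {n : ℕ} (hn : 1 < n) :
    ∃ q, q.Prime ∧ q ∣ n ∧ ∀ r, r.Prime → r ∣ n → r ≤ q := by
  have hne : n.primeFactors.Nonempty := Nat.nonempty_primeFactors.2 hn
  have hmem := Finset.max'_mem _ hne
  exact ⟨_, Nat.prime_of_mem_primeFactors hmem, Nat.dvd_of_mem_primeFactors hmem,
    fun r hr hd => Finset.le_max' _ _ (Nat.mem_primeFactors.2 ⟨hr, hd, by omega⟩)⟩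

namespace PrimeCovers

variable {G : Type*} [Group G] [Finite G]

/-- If covering pairs have prime index, then a Sylow subgroup for the largest prime divisor of the
order is normal. -/
theorem normal_sylow (h : PrimeCovers G) {q : ℕ} [Fact q.Prime]
    (hq : ∀ r, r.Prime → r ∣ Nat.card G → r ≤ q) (Q : Sylow q G) : (Q : Subgroup G).Normal := by
  rw [← Subgroup.normalizer_eq_top_iff]
  by_contra hne
  obtain ⟨M, hM, hle⟩ := (eq_top_or_exists_le_coatom (Subgroup.normalizer (Q : Set G))).resolve_left
    hne
  have hr : M.index.Prime := by
    have := h M ⊤ (covBy_top_iff.2 hM)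
    rwa [Subgroup.relIndex_top_right] at this
  have hQM : (Q : Subgroup G) ≤ M := Subgroup.le_normalizer.trans hle
  have h1 : (Subgroup.normalizer (Q : Set G)).index ≡ 1 [MOD q] := by
    have := card_sylow_modEq_one q G
    rwa [Q.card_eq_index_normalizer] at this
  have h2 : (Subgroup.normalizer (Q : Set G)).relIndex M ≡ 1 [MOD q] := by
    have := card_sylow_modEq_one q M
    rw [(Q.subtype hQM).card_eq_index_normalizer] at this
    have hQ : ((Q.subtype hQM : Sylow q M) : Set M) =
        ((Q : Subgroup G).subgroupOf M : Subgroup M) := rfl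
    rwa [hQ, ← Subgroup.subgroupOf_normalizer_eq hQM] at this
  have h3 := Subgroup.relIndex_mul_index hle
  have h4 : M.index ≡ 1 [MOD q] := by
    have := (h2.mul_right M.index).symm.trans (h3 ▸ h1)
    simpa using this
  have h5 := hq _ hr M.index_dvd_card
  have h6 := (Nat.modEq_iff_dvd' hr.one_lt.le).1 h4.symm
  have := Nat.le_of_dvd (Nat.sub_pos_of_lt hr.one_lt) h6
  have := hr.one_lt
  omega

/-- A group whose covering pairs have prime index has a normal complement for a prime which is at
most every prime divisor of the order. -/
theorem exists_normal_complement (h : PrimeCovers G) {p : ℕ} (hp : p.Prime)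
    (hmin : ∀ r, r.Prime → r ∣ Nat.card G → p ≤ r) :
    ∃ K : Subgroup G, K.Normal ∧ ¬ p ∣ Nat.card K ∧ ∃ a, K.index = p ^ a := by
  induction hn : Nat.card G using Nat.strong_induction_on generalizing G with
  | _ n ih =>
  subst hn
  rcases subsingleton_or_nontrivial G with hG | hG
  · refine ⟨⊥, inferInstance, ?_, 0, ?_⟩
    · simpa using hp.one_lt.ne'
    · simp
  obtain ⟨q, hq, hqd, hmax⟩ := Nat.exists_max_prime_dvd (Finite.one_lt_card (α := G))
  have := Fact.mk hq
  obtain rfl | hne := eq_or_ne p q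
  · refine ⟨⊥, inferInstance, by simpa using hp.one_lt.ne', ?_⟩
    exact ⟨_, Subgroup.index_bot.trans (Nat.eq_prime_pow_of_unique_prime_dvd Nat.card_pos.ne'
      fun {r} hr hd => le_antisymm (hmax r hr hd) (hmin r hr hd))⟩
  let Q : Sylow q G := default
  have hQ := h.normal_sylow hmax Q
  have hQ1 : (Q : Subgroup G) ≠ ⊥ := Q.ne_bot_of_dvd_card hqd
  obtain ⟨K, hK, hKp, a, ha⟩ := ih _ (Subgroup.card_quotient_lt hQ1)
    (h.of_surjective (QuotientGroup.mk'_surjective (Q : Subgroup G)))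
    (fun r hr hd => hmin r hr (hd.trans (Q : Subgroup G).card_quotient_dvd_card)) rfl
  refine ⟨K.comap (QuotientGroup.mk' (Q : Subgroup G)), hK.comap _, fun hd => ?_, a, ?_⟩
  · obtain ⟨b, hb⟩ := IsPGroup.iff_card.1 Q.2
    have hc : Nat.card (K.comap (QuotientGroup.mk' (Q : Subgroup G))) = Nat.card K * q ^ b := by
      have h1 := (K.comap (QuotientGroup.mk' (Q : Subgroup G))).card_mul_index
      rw [Subgroup.index_comap_of_surjective _ (QuotientGroup.mk'_surjective (Q : Subgroup G)),
        (Q : Subgroup G).card_eq_card_quotient_mul_card_subgroup, ← K.card_mul_index, hb] at h1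
      refine Nat.eq_of_mul_eq_mul_right (Nat.pos_of_ne_zero K.index_ne_zero_of_finite) ?_
      rw [h1]
      ring
    rw [hc] at hd
    rcases hp.dvd_mul.1 hd with hd | hd
    · exact hKp hd
    · exact hne ((Nat.prime_dvd_prime_iff_eq hp hq).1 (hp.dvd_of_dvd_pow hd))
  · rw [Subgroup.index_comap_of_surjective _ (QuotientGroup.mk'_surjective (Q : Subgroup G)), ha]

theorem exists_normal_prime_card [Nontrivial G] (h : PrimeCovers G) :
    ∃ N : Subgroup G, N.Normal ∧ (Nat.card N).Prime := by
  obtain ⟨q, hq, hqd, hmax⟩ := Nat.exists_max_prime_dvd (Finite.one_lt_card (α := G))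
  have := Fact.mk hq
  let Q : Sylow q G := default
  have hQ := h.normal_sylow hmax Q
  have hQ1 : (Q : Subgroup G) ≠ ⊥ := Q.ne_bot_of_dvd_card hqd
  obtain ⟨K, hK⟩ := Subgroup.exists_right_complement'_of_coprime Q.card_coprime_index
  have hnt : Nontrivial (Q : Subgroup G) := (Subgroup.nontrivial_iff_ne_bot _).2 hQ1
  let Z : Subgroup G := (Subgroup.center (Q : Subgroup G)).map (Q : Subgroup G).subtype
  have hZ1 : Z ≠ ⊥ := by
    have := Q.2.center_nontrivial
    rw [Ne, Subgroup.map_eq_bot_iff_of_injective _ (Subgroup.subtype_injective _)]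
    exact (Subgroup.nontrivial_iff_ne_bot _).1 this
  have hZn : Z.Normal := inferInstance
  have hZQ : Z ≤ Q := Subgroup.map_subtype_le _
  obtain ⟨N, -, hNmin⟩ := exists_minimal_le_of_wellFoundedLT
    (fun N : Subgroup G => N.Normal ∧ N ≠ ⊥ ∧ N ≤ Z) Z ⟨hZn, hZ1, le_rfl⟩
  obtain ⟨hNn, hN1, hNZ⟩ := hNmin.prop
  refine ⟨N, hNn, ?_⟩
  have hd : Disjoint K N := (hK.disjoint.mono_left (hNZ.trans hZQ)).symm
  rw [← Subgroup.relIndex_sup_of_disjoint hd]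
  refine h _ _ ⟨left_lt_sup.2 fun hle => hN1 (disjoint_self.1 (hd.mono_left hle)),
    fun L hKL hLN => ?_⟩
  have hnorm : (L ⊓ N).Normal := by
    rw [← Subgroup.normalizer_eq_top_iff, eq_top_iff, ← hK.sup_eq_top]
    refine sup_le ?_ ?_
    · refine Subgroup.le_normalizer_iff.2 fun g hg l hl => ?_
      obtain ⟨z, hz, hzl⟩ := hNZ hl.2
      have hc : g * l = l * g := by
        rw [← hzl]
        exact congrArg Subtype.val (Subgroup.mem_center_iff.1 hz ⟨g, hg⟩)
      rwa [hc, mul_inv_cancel_right]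
    · refine Subgroup.le_normalizer_iff.2 fun k hk l hl =>
        Subgroup.mem_inf.2 ⟨?_, hNn.conj_mem l hl.2 k⟩
      exact mul_mem (mul_mem (hKL.le hk) hl.1) (inv_mem (hKL.le hk))
  rcases eq_or_ne (L ⊓ N) ⊥ with hbot | hbot
  · refine hKL.not_ge fun l hl => ?_
    obtain ⟨k, hk, n, hn, rfl⟩ := Subgroup.mem_sup_of_normal_right.1 (hLN.le hl)
    have hkL : k ∈ L := hKL.le hk
    have hnL : n ∈ L := by simpa using mul_mem (inv_mem hkL) hl
    have : n ∈ L ⊓ N := ⟨hnL, hn⟩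
    rw [hbot, Subgroup.mem_bot] at this
    simpa [this] using hk
  · have := hNmin.le_of_le ⟨hnorm, hbot, inf_le_right.trans hNZ⟩ inf_le_right
    exact hLN.not_ge (sup_le hKL.le (le_inf_iff.1 this).1)

theorem isSupersolvable (h : PrimeCovers G) : IsSupersolvable G := by
  induction hn : Nat.card G using Nat.strong_induction_on generalizing G with
  | _ n ih =>
  subst hn
  rcases subsingleton_or_nontrivial G with hG | hG
  · exact ⟨0, fun _ => ⊥, rfl, Subsingleton.elim _ _, fun _ => inferInstance, by simp⟩
  obtain ⟨N, hN, hp⟩ := h.exists_normal_prime_card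
  have := Fact.mk hp
  exact IsSupersolvable.of_quotient (isCyclic_of_prime_card rfl)
    (ih _ (Subgroup.card_quotient_lt (Subgroup.ne_bot_of_prime_card hp))
      (h.of_surjective (QuotientGroup.mk'_surjective N)) rfl)

end PrimeCovers

/-- `G` has a normal subgroup of order prime to `p` and of index a power of `p`. -/
def HasNormalComplement (p : ℕ) (G : Type*) [Group G] : Prop :=
  ∃ K : Subgroup G, K.Normal ∧ ¬ p ∣ Nat.card K ∧ ∃ a, K.index = p ^ a

section Fusion

open Subgroup

open scoped commutatorElement

variable {G : Type*} [Group G] [Finite G] {p : ℕ} [hp : Fact p.Prime]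

theorem Sylow.sup_eq_top_of_index_eq_pow (Q : Sylow p G) {K : Subgroup G} {a : ℕ}
    (hK : K.index = p ^ a) : K ⊔ Q = ⊤ := by
  rw [← index_eq_one]
  have h1 : (K ⊔ Q).index ∣ p ^ a := hK ▸ index_dvd_of_le le_sup_left
  obtain ⟨b, -, hb⟩ := (Nat.dvd_prime_pow hp.out).1 h1
  have h2 : (K ⊔ Q).index ∣ (Q : Subgroup G).index := index_dvd_of_le le_sup_right
  rcases b with _ | b
  · simpa using hb
  · exact absurd ((hb ▸ dvd_pow_self p b.succ_ne_zero).trans h2) Q.not_dvd_index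

/-- In the normalizer of a `p`-subgroup `U`, a normal `p`-complement centralizes `U`. -/
theorem HasNormalComplement.exists_le_centralizer {U : Subgroup G} (hU : IsPGroup p U)
    (h : HasNormalComplement p (normalizer (U : Set G))) :
    ∃ K : Subgroup (normalizer (U : Set G)), K.Normal ∧
      (∀ Q : Sylow p (normalizer (U : Set G)), K ⊔ Q = ⊤) ∧
      ∀ k ∈ K, (k : G) ∈ centralizer (U : Set G) := by
  obtain ⟨K, hK, hKp, a, ha⟩ := h
  refine ⟨K, hK, fun Q => Q.sup_eq_top_of_index_eq_pow ha, fun k hk => ?_⟩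
  have hUN : IsPGroup p (U.subgroupOf (normalizer (U : Set G))) :=
    hU.comap_of_injective _ (subtype_injective _)
  have hd : Disjoint K (U.subgroupOf (normalizer (U : Set G))) := by
    apply disjoint_of_coprime_natCard
    obtain ⟨b, hb⟩ := IsPGroup.iff_card.1 hUN
    rw [hb]
    exact Nat.Coprime.pow_right _ (((Nat.Prime.coprime_iff_not_dvd hp.out).2 hKp).symm)
  rw [mem_centralizer_iff]
  intro u hu
  have := commute_of_normal_of_disjoint _ _ hK inferInstance hd k ⟨u, le_normalizer hu⟩ hk hu
  exact congrArg Subtype.val this.eq.symm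

theorem HasNormalComplement.exists_conj_le_sylow {U A B : Subgroup G} (hU : IsPGroup p U)
    (h : HasNormalComplement p (normalizer (U : Set G))) (hA : IsPGroup p A) (hB : IsPGroup p B)
    (hAU : A ≤ normalizer (U : Set G)) (hBU : B ≤ normalizer (U : Set G)) :
    ∃ c ∈ centralizer (U : Set G), ∃ R : Sylow p G, A ≤ R ∧ ∀ b ∈ B, c * b * c⁻¹ ∈ R := by
  obtain ⟨K, hK, hsup, hcent⟩ := h.exists_le_centralizer hU
  obtain ⟨S, hS⟩ := (hA.comap_of_injective (normalizer (U : Set G)).subtype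
    (subtype_injective _)).exists_le_sylow
  obtain ⟨T, hT⟩ := (hB.comap_of_injective (normalizer (U : Set G)).subtype
    (subtype_injective _)).exists_le_sylow
  obtain ⟨n, hn⟩ := MulAction.exists_smul_eq (normalizer (U : Set G)) T S
  obtain ⟨s, hs, k, hk, rfl⟩ : ∃ s ∈ (S : Subgroup _), ∃ k ∈ K, s * k = n :=
    mem_sup_of_normal_right.1 (by rw [sup_comm, hsup S]; trivial)
  have hkT : k • T = S := by
    rw [mul_smul] at hn
    rw [← inv_smul_eq_iff.2 hn.symm, Sylow.smul_eq_iff_mem_normalizer]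
    exact le_normalizer (inv_mem hs)
  obtain ⟨R, hR⟩ := (S.2.map (normalizer (U : Set G)).subtype).exists_le_sylow
  refine ⟨k, hcent k hk, R, fun a ha => ?_, fun b hb => ?_⟩
  · exact hR ⟨⟨a, hAU ha⟩, hS ha, rfl⟩
  · refine hR ⟨k * ⟨b, hBU hb⟩ * k⁻¹, ?_, rfl⟩
    rw [← hkT]
    exact smul_mem_pointwise_smul (⟨b, hBU hb⟩ : normalizer (U : Set G)) (MulAut.conj k) _ (hT hb)

theorem IsPGroup.lt_normalizer_inf {D S : Subgroup G} (hS : IsPGroup p S) (hDS : D < S) :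
    D < normalizer (D : Set G) ⊓ S := by
  have := hS.isNilpotent
  have h1 : D.subgroupOf S < ⊤ := lt_top_iff_ne_top.2 fun h => hDS.not_ge (subgroupOf_eq_top.1 h)
  have h2 := Group.normalizerCondition_of_isNilpotent _ h1
  rw [← subgroupOf_normalizer_eq hDS.le] at h2
  refine lt_of_le_not_ge (le_inf le_normalizer hDS.le) fun hle => h2.not_ge fun x hx => ?_
  exact hle ⟨hx, x.2⟩

theorem Subgroup.card_lt_card_of_lt {A B : Subgroup G} (h : A < B) : Nat.card A < Nat.card B :=
  lt_of_not_ge fun hle => h.ne (eq_of_le_of_card_ge h.le hle)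

/-- If normalizers of nontrivial `p`-subgroups have normal `p`-complements, then any two Sylow
subgroups are conjugate under the centralizer of their intersection. -/
theorem Sylow.exists_mem_centralizer_smul_eq
    (hNC : ∀ U : Subgroup G, IsPGroup p U → U ≠ ⊥ →
      HasNormalComplement p (normalizer (U : Set G)))
    (S T : Sylow p G) :
    ∃ c ∈ centralizer ((S ⊓ T : Subgroup G) : Set G), c • T = S := by
  induction hn : Nat.card G - Nat.card (S ⊓ T : Subgroup G) using Nat.strong_induction_on
    generalizing S T with
  | _ n ih =>
  subst hn
  have ih' : ∀ S' T' : Sylow p G,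
      Nat.card (S ⊓ T : Subgroup G) < Nat.card (S' ⊓ T' : Subgroup G) →
      ∃ c ∈ centralizer ((S' ⊓ T' : Subgroup G) : Set G), c • T' = S' := fun S' T' hlt => by
    have := card_le_card_group (S' ⊓ T' : Subgroup G)
    exact ih _ (by omega) S' T' rfl
  set D : Subgroup G := S ⊓ T with hD
  have hDp : IsPGroup p D := S.2.to_le inf_le_left
  by_cases hD1 : D = ⊥
  · obtain ⟨c, hc⟩ := MulAction.exists_smul_eq G T S
    refine ⟨c, ?_, hc⟩
    rw [hD1, mem_centralizer_iff]
    simp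
  by_cases hST : S = T
  · exact ⟨1, one_mem _, by rw [one_smul, hST]⟩
  have hDS : D < S := lt_of_le_of_ne inf_le_left fun h =>
    hST (Sylow.ext (S.3 T.2 (inf_eq_left.1 h))).symm
  have hDT : D < T := lt_of_le_of_ne inf_le_right fun h =>
    hST (Sylow.ext (T.3 S.2 (inf_eq_right.1 h)))
  have hA := S.2.lt_normalizer_inf hDS
  have hB := T.2.lt_normalizer_inf hDT
  obtain ⟨c, hc, R, hAR, hBR⟩ := (hNC D hDp hD1).exists_conj_le_sylow hDp
    (S.2.to_le inf_le_right) (T.2.to_le inf_le_right) inf_le_left inf_le_left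
      (A := normalizer (D : Set G) ⊓ S) (B := normalizer (D : Set G) ⊓ T)
  have hcT : ∀ t ∈ T, c * t * c⁻¹ ∈ c • T := fun t ht =>
    smul_mem_pointwise_smul t (MulAut.conj c) (T : Subgroup G) ht
  obtain ⟨c₁, hc₁, h₁⟩ := ih' S R ((card_lt_card_of_lt hA).trans_le
    (card_le_of_le (le_inf inf_le_right hAR)))
  have hB' : (normalizer (D : Set G) ⊓ T).map (MulAut.conj c).toMonoidHom ≤
      (R ⊓ (c • T : Sylow p G) : Subgroup G) := by
    rintro _ ⟨b, hb, rfl⟩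
    exact ⟨hBR b hb, hcT b hb.2⟩
  obtain ⟨c₂, hc₂, h₂⟩ := ih' R (c • T) (by
    refine (card_lt_card_of_lt hB).trans_le (le_trans (le_of_eq ?_) (card_le_of_le hB'))
    exact (card_map_of_injective (MulAut.conj c).injective).symm)
  refine ⟨c₁ * (c₂ * c), mul_mem ?_ (mul_mem ?_ hc), by rw [mul_smul, mul_smul, h₂, h₁]⟩
  · exact centralizer_le (hA.le.trans (le_inf inf_le_right hAR)) hc₁
  · refine centralizer_le (fun d hd => hB' ⟨d, hB.le hd, ?_⟩) hc₂
    have := mem_centralizer_iff.1 hc d hd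
    simp [← this]

/-- Under the same hypothesis, a Sylow subgroup controls its own fusion. -/
theorem Sylow.exists_mem_conj_eq
    (hNC : ∀ U : Subgroup G, IsPGroup p U → U ≠ ⊥ →
      HasNormalComplement p (normalizer (U : Set G)))
    (P : Sylow p G) (hP : (P : Subgroup G) ≠ ⊥) {x g : G}
    (hx : x ∈ P) (hg : g * x * g⁻¹ ∈ P) : ∃ u ∈ P, u * x * u⁻¹ = g * x * g⁻¹ := by
  obtain ⟨c, hc, hcP⟩ := Sylow.exists_mem_centralizer_smul_eq hNC P (g • P)
  have hgx : g * x * g⁻¹ ∈ g • P := smul_mem_pointwise_smul x (MulAut.conj g) (P : Subgroup G) hx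
  have hcy := mem_centralizer_iff.1 hc _ ⟨hg, hgx⟩
  rw [← mul_smul, Sylow.smul_eq_iff_mem_normalizer] at hcP
  obtain ⟨K, hK, hsup, hcent⟩ := (hNC P P.2 hP).exists_le_centralizer P.2
  have hle : (P : Subgroup G) ≤ normalizer ((P : Subgroup G) : Set G) := le_normalizer
  obtain ⟨k, hk, u, hu, hku⟩ : ∃ k ∈ K, ∃ u ∈ (P.subtype hle : Subgroup _),
      k * u = ⟨c * g, hcP⟩ :=
    mem_sup_of_normal_left.1 (by rw [hsup (P.subtype hle)]; trivial)
  have hu : (u : G) ∈ P := hu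
  have hku : (k : G) * u = c * g := congrArg Subtype.val hku
  have hkc := mem_centralizer_iff.1 (hcent k hk) _ (mul_mem (mul_mem hu hx) (inv_mem hu))
  refine ⟨u, hu, ?_⟩
  calc (u : G) * x * (u : G)⁻¹ = (u * x * (u : G)⁻¹) * k * (k : G)⁻¹ := by group
    _ = (k * u) * x * (k * u : G)⁻¹ := by rw [hkc]; group
    _ = c * (g * x * g⁻¹) * c⁻¹ := by rw [hku]; group
    _ = g * x * g⁻¹ := by rw [← hcy]; group

theorem commutator_ne_top_of_hasNormalComplement
    (hNC : ∀ U : Subgroup G, IsPGroup p U → U ≠ ⊥ →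
      HasNormalComplement p (normalizer (U : Set G)))
    (P : Sylow p G) (hP : (P : Subgroup G) ≠ ⊥) :
    commutator G ≠ ⊤ := by
  intro htop
  have hfoc := commutator_inf_eq_focalSubgroup P
  rw [htop, top_inf_eq] at hfoc
  have hle : (P : Subgroup G) ≤ ⁅(P : Subgroup G), (P : Subgroup G)⁆ := by
    conv_lhs => rw [hfoc]
    rw [focalSubgroup_def, closure_le]
    rintro _ ⟨hmem, x, hx, u, rfl⟩
    have hu : u * x⁻¹ * u⁻¹ ∈ P := by
      have := mul_mem (inv_mem hx) hmem
      rwa [commutatorElement_def, ← mul_assoc, ← mul_assoc, inv_mul_cancel_left] at this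
    obtain ⟨v, hv, hvu⟩ := Sylow.exists_mem_conj_eq hNC P hP (inv_mem hx) hu
    have : ⁅x, u⁆ = ⁅x, v⁆ := by
      calc ⁅x, u⁆ = x * (u * x⁻¹ * u⁻¹) := by group
        _ = ⁅x, v⁆ := by rw [← hvu]; group
    rw [this]
    exact commutator_mem_commutator hx hv
  have := (nontrivial_iff_ne_bot _).2 hP
  have := P.2.isNilpotent
  refine (Group.IsSolvable.commutator_lt_top_of_nontrivial (P : Subgroup G)).ne ?_
  rw [← map_subtype_inj]
  refine le_antisymm (map_mono le_top) ?_
  rwa [map_subtype_commutator, ← MonoidHom.range_eq_map, range_subtype]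

end Fusion

section Main

variable {G : Type*} [Group G] [Finite G]

open Subgroup

open scoped IsMulCommutative

/-- A simple group whose proper subgroups all have prime covers is not perfect. -/
theorem IsSimpleGroup.commutator_ne_top [IsSimpleGroup G]
    (h : ∀ K : Subgroup G, K ≠ ⊤ → PrimeCovers K) : commutator G ≠ ⊤ := by
  have hp : (Nat.card G).minFac.Prime := Nat.minFac_prime Finite.one_lt_card.ne'
  have := Fact.mk hp
  intro htop
  refine commutator_ne_top_of_hasNormalComplement (p := (Nat.card G).minFac) (fun U hU hU1 => ?_)
    default (Sylow.ne_bot_of_dvd_card _ (Nat.minFac_dvd _)) htop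
  have hN : normalizer (U : Set G) ≠ ⊤ := by
    intro hN
    rcases (normalizer_eq_top_iff.1 hN).eq_bot_or_eq_top with hU' | rfl
    · exact hU1 hU'
    · have := (hU.of_equiv topEquiv).isNilpotent
      exact (Group.IsSolvable.commutator_lt_top_of_nontrivial G).ne htop
  exact (h _ hN).exists_normal_complement hp fun r hr hd =>
    Nat.minFac_le_of_dvd hr.two_le (hd.trans (card_subgroup_dvd_card _))

theorem AllMaxChainsSameLength.primeCovers (h : AllMaxChainsSameLength (⊥ : Subgroup G)) :
    PrimeCovers G := by
  induction hn : Nat.card G using Nat.strong_induction_on generalizing G with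
  | _ n ih =>
  subst hn
  have hsub : ∀ K : Subgroup G, K ≠ ⊤ → PrimeCovers K := fun K hK =>
    ih _ (by simpa using card_lt_card_of_lt hK.lt_top) (h.subgroup K) rfl
  intro H K hHK
  by_cases hK : K ≠ ⊤
  · exact (hsub K hK).prime_relIndex hHK le_rfl
  obtain rfl : K = ⊤ := not_not.1 hK
  have : Nontrivial G := by
    by_contra hG
    rw [not_nontrivial_iff_subsingleton] at hG
    exact hHK.ne (Subsingleton.elim _ _)
  obtain ⟨M, hM, hMp⟩ : ∃ M : Subgroup G, M ⋖ ⊤ ∧ M.index.Prime := by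
    by_cases hs : ∃ N : Subgroup G, N.Normal ∧ N ≠ ⊥ ∧ N ≠ ⊤
    · obtain ⟨N, hN, hN1, hN2⟩ := hs
      have hQ := ih _ (card_quotient_lt hN1) (h.of_surjective (QuotientGroup.mk'_surjective N)) rfl
      have : Nontrivial (G ⧸ N) := QuotientGroup.nontrivial_iff.2 hN2
      obtain ⟨M, -, hM⟩ := exists_le_covBy_of_lt (bot_lt_top : (⊥ : Subgroup (G ⧸ N)) < ⊤)
      refine ⟨M.comap (QuotientGroup.mk' N), ?_, ?_⟩
      · simpa using covBy_comap_of_surjective (QuotientGroup.mk'_surjective N) hM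
      · rw [index_comap_of_surjective _ (QuotientGroup.mk'_surjective N)]
        simpa using hQ _ _ hM
    · have hsimple : IsSimpleGroup G := ⟨fun N hN => by
        by_contra hne
        exact hs ⟨N, hN, not_or.1 hne⟩⟩
      have hbot : commutator G = ⊥ :=
        (IsSimpleGroup.eq_bot_or_eq_top_of_normal _ inferInstance).resolve_right
          (IsSimpleGroup.commutator_ne_top hsub)
      have hcomm : IsMulCommutative G := (commutator_eq_bot_iff G).1 hbot
      refine ⟨⊥, bot_covBy_top, ?_⟩
      rw [index_bot]
      exact Group.is_simple_iff_prime_card.1 hsimple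
  rw [allMaxChainsSameLength_bot_iff] at h
  obtain ⟨m, hm⟩ := CovChain.exists_of_le (bot_le : ⊥ ≤ M)
  obtain ⟨k, hk⟩ := CovChain.exists_of_le (bot_le : ⊥ ≤ H)
  have hmk := h _ _ (hm.step hM) (hk.step hHK)
  have hm' := hm.cardFactors_card (hsub M hM.ne) le_rfl
  have hk' := hk.cardFactors_card (hsub H hHK.ne) le_rfl
  rw [relIndex_top_right, ← ArithmeticFunction.cardFactors_eq_one_iff_prime]
  have e1 := congrArg ArithmeticFunction.cardFactors M.card_mul_index
  have e2 := congrArg ArithmeticFunction.cardFactors H.card_mul_index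
  rw [ArithmeticFunction.cardFactors_mul Nat.card_pos.ne' index_ne_zero_of_finite] at e1 e2
  have e3 := ArithmeticFunction.cardFactors_eq_one_iff_prime.2 hMp
  omega

end Main

theorem stmt_2 {G : Type*} [Group G] [Finite G] :
    IsSupersolvable G ↔ AllMaxChainsSameLength (⊥ : Subgroup G) :=
  ⟨fun h => h.primeCovers.allMaxChainsSameLength, fun h => h.primeCovers.isSupersolvable⟩
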